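/- (Equivalence of the psc-based and sc-based formulations of IMM) An execution graph G is IMM-consistent if and only if there exists a strict total order sc on its SC fence events F^sc such that the other IMM-consistency axioms hold, the relation ar_sc = rf_e ∪ bob ∪ ppo ∪ detour ∪ sc ∪ [W^strong];po;[W] (i.e., ar with psc replaced by sc) is acyclic, and sc;hb;(eco;hb)^? is irreflexive. Moreover, if G is IMM-consistent, then there exists such an sc for which G is also IMM_sc-consistent in the variant that uses hb_RC11 in place of hb (so this variant is a weaker model than IMM). -/

import Mathlib

/-! ## Basic definitions: events, labels, relations -/

abbrev Loc := ℕ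
abbrev Val := ℕ

inductive Mode
  | rlx | acq | rel | acqrel | sc
deriving DecidableEq

inductive ExFlag
  | notex | ex
deriving DecidableEq

inductive Strength
  | normal | strong
deriving DecidableEq

inductive Label
  | read (o : Mode) (x : Loc) (v : Val) (s : ExFlag)
  | write (o : Mode) (x : Loc) (v : Val) (st : Strength)
  | fence (o : Mode)
deriving DecidableEq

inductive Event
  | init (x : Loc)
  | ev (tid : ℕ) (sn : ℚ)
deriving DecidableEq

def Event.isInit : Event → Prop
  | .init _ => True
  | .ev _ _ => False

/-- the set of initialization events -/
def InitE : Set Event := {e | e.isInit}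

/-- the `sequenced-before` partial order on events: initialization events precede all
non-initialization events, and events of the same thread are ordered by serial number -/
def evLt : Event → Event → Prop
  | .init _, .ev _ _ => True
  | .ev i n, .ev j m => i = j ∧ n < m
  | _, _ => False

abbrev REv := Event → Event → Prop

/-- relational composition `r ; s` -/
def seqR (r s : REv) : REv := fun a c => ∃ b, r a b ∧ s b c

infixr:70 " ⬝ " => seqR

/-- identity relation on a set: `[A]` -/
def eqv (A : Set Event) : REv := fun a b => a = b ∧ a ∈ A

notation:max "⦗" A "⦘" => eqv A

/-- union of relations -/
def runion (r s : REv) : REv := fun a b => r a b ∨ s a b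

infixl:65 " ∪ᵣ " => runion

/-- reflexive closure `r^?` -/
def rcl (r : REv) : REv := fun a b => a = b ∨ r a b

/-- transitive closure `r⁺` -/
def tcl (r : REv) : REv := Relation.TransGen r

/-- reflexive-transitive closure `r*` -/
def rtcl (r : REv) : REv := Relation.ReflTransGen r

/-- inverse relation `r⁻¹` -/
def transp (r : REv) : REv := fun a b => r b a

def rdom (r : REv) : Set Event := {a | ∃ b, r a b}

def rcodom (r : REv) : Set Event := {b | ∃ a, r a b}

/-- immediate edges: `imm(r) = r ∖ r;r` -/
def immediate (r : REv) : REv := fun a b => r a b ∧ ¬ (r ⬝ r) a b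

def acyclic (r : REv) : Prop := Irreflexive (tcl r)

/-- `r` totally orders `A` -/
def totalOn (A : Set Event) (r : REv) : Prop :=
  ∀ a ∈ A, ∀ b ∈ A, a ≠ b → r a b ∨ r b a

def Label.locOf : Label → Option Loc
  | .read _ x _ _ => some x
  | .write _ x _ _ => some x
  | .fence _ => none

def Label.valOf : Label → Option Val
  | .read _ _ v _ => some v
  | .write _ _ v _ => some v
  | .fence _ => none

/-! ## IMM execution graphs -/

structure Execution where
  E : Set Event
  lab : Event → Label
  rmw : REv
  data : REv
  addr : REv
  ctrl : REv
  casdep : REv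
  rf : REv
  co : REv

namespace Execution

variable (G : Execution)

def loc (e : Event) : Option Loc := (G.lab e).locOf
def valu (e : Event) : Option Val := (G.lab e).valOf

/-- read events -/
def R : Set Event := {e | e ∈ G.E ∧ ∃ o x v s, G.lab e = .read o x v s}
/-- write events -/
def W : Set Event := {e | e ∈ G.E ∧ ∃ o x v st, G.lab e = .write o x v st}
/-- fence events -/
def F : Set Event := {e | e ∈ G.E ∧ ∃ o, G.lab e = .fence o}
/-- acquire reads -/
def Racq : Set Event := {e | e ∈ G.E ∧ ∃ x v s, G.lab e = .read .acq x v s}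
/-- exclusive reads -/
def Rex : Set Event := {e | e ∈ G.E ∧ ∃ o x v, G.lab e = .read o x v .ex}
/-- release writes -/
def Wrel : Set Event := {e | e ∈ G.E ∧ ∃ x v st, G.lab e = .write .rel x v st}
/-- strong writes -/
def Wstrong : Set Event := {e | e ∈ G.E ∧ ∃ o x v, G.lab e = .write o x v .strong}
/-- writes to location `x` -/
def Wloc (x : Loc) : Set Event := {e | e ∈ G.W ∧ G.loc e = some x}
/-- reads from location `x` -/
def Rloc (x : Loc) : Set Event := {e | e ∈ G.R ∧ G.loc e = some x}
/-- SC fences -/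
def Fsc : Set Event := {e | e ∈ G.E ∧ G.lab e = .fence .sc}
/-- fences of mode exactly `rel` -/
def Frel : Set Event := {e | e ∈ G.E ∧ G.lab e = .fence .rel}
/-- fences whose mode is at least `rel` (i.e. `rel`, `acqrel` or `sc`) -/
def FgeRel : Set Event :=
  {e | e ∈ G.E ∧ (G.lab e = .fence .rel ∨ G.lab e = .fence .acqrel ∨ G.lab e = .fence .sc)}
/-- fences whose mode is at least `acq` (i.e. `acq`, `acqrel` or `sc`) -/
def FgeAcq : Set Event :=
  {e | e ∈ G.E ∧ (G.lab e = .fence .acq ∨ G.lab e = .fence .acqrel ∨ G.lab e = .fence .sc)}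

/-- program order -/
def po : REv := fun a b => a ∈ G.E ∧ b ∈ G.E ∧ evLt a b

/-- both events access the same location -/
def sameLoc : REv := fun a b => ∃ x, G.loc a = some x ∧ G.loc b = some x

/-- `po|loc` -/
def poloc : REv := fun a b => G.po a b ∧ G.sameLoc a b

def rfi : REv := fun a b => G.rf a b ∧ G.po a b
def rfe : REv := fun a b => G.rf a b ∧ ¬ G.po a b
def coi : REv := fun a b => G.co a b ∧ G.po a b
def coe : REv := fun a b => G.co a b ∧ ¬ G.po a b

/-- from-read -/
def fr : REv := transp G.rf ⬝ G.co
def fri : REv := fun a b => G.fr a b ∧ G.po a b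
def fre : REv := fun a b => G.fr a b ∧ ¬ G.po a b

/-- release sequence -/
def rs : REv :=
  ⦗G.W⦘ ⬝ G.poloc ⬝ ⦗G.W⦘ ∪ᵣ ⦗G.W⦘ ⬝ rtcl (rcl G.poloc ⬝ G.rf ⬝ G.rmw)

/-- release prefix -/
def release : REv := (⦗G.Wrel⦘ ∪ᵣ ⦗G.FgeRel⦘ ⬝ G.po) ⬝ G.rs

/-- synchronizes with -/
def sw : REv :=
  G.release ⬝ (G.rfi ∪ᵣ rcl G.poloc ⬝ G.rfe) ⬝ (⦗G.Racq⦘ ∪ᵣ G.po ⬝ ⦗G.FgeAcq⦘)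

/-- happens-before -/
def hb : REv := tcl (G.po ∪ᵣ G.sw)

/-- extended coherence order -/
def eco : REv := G.rf ∪ᵣ G.co ⬝ rcl G.rf ∪ᵣ G.fr ⬝ rcl G.rf

/-- barrier order -/
def bob : REv :=
  G.po ⬝ ⦗G.Wrel⦘ ∪ᵣ ⦗G.Racq⦘ ⬝ G.po ∪ᵣ G.po ⬝ ⦗G.F⦘ ∪ᵣ ⦗G.F⦘ ⬝ G.po ∪ᵣ
    ⦗G.Wrel⦘ ⬝ G.poloc ⬝ ⦗G.W⦘

/-- syntactic dependencies -/
def deps : REv :=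
  G.data ∪ᵣ G.ctrl ∪ᵣ G.addr ⬝ rcl G.po ∪ᵣ G.casdep ∪ᵣ ⦗G.Rex⦘ ⬝ G.po

/-- preserved program order -/
def ppo : REv := ⦗G.R⦘ ⬝ tcl (G.deps ∪ᵣ G.rfi) ⬝ ⦗G.W⦘

def detour : REv := fun a b => (G.coe ⬝ G.rfe) a b ∧ G.po a b

/-- partial SC fence order -/
def psc : REv := ⦗G.Fsc⦘ ⬝ G.hb ⬝ G.eco ⬝ G.hb ⬝ ⦗G.Fsc⦘

/-- the acyclicity relation of IMM -/
def ar : REv :=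
  G.rfe ∪ᵣ G.bob ∪ᵣ G.ppo ∪ᵣ G.detour ∪ᵣ G.psc ∪ᵣ ⦗G.Wstrong⦘ ⬝ G.po ⬝ ⦗G.W⦘

/-! RC11-style variants -/

def rsRC11 : REv := ⦗G.W⦘ ⬝ rcl G.poloc ⬝ rtcl (G.rf ⬝ G.rmw)

def releaseRC11 : REv := (⦗G.Wrel⦘ ∪ᵣ ⦗G.FgeRel⦘ ⬝ G.po) ⬝ G.rsRC11

def swRC11 : REv := G.releaseRC11 ⬝ G.rf ⬝ (⦗G.Racq⦘ ∪ᵣ G.po ⬝ ⦗G.FgeAcq⦘)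

def hbRC11 : REv := tcl (G.po ∪ᵣ G.swRC11)

end Execution

/-- Well-formedness of an IMM execution graph -/
structure ExecWf (G : Execution) : Prop where
  finE : G.E.Finite
  init_lab : ∀ x, Event.init x ∈ G.E →
    G.lab (Event.init x) = Label.write .rlx x 0 .normal
  read_mode : ∀ e ∈ G.E, ∀ o x v s, G.lab e = .read o x v s → o = Mode.rlx ∨ o = Mode.acq
  write_mode : ∀ e ∈ G.E, ∀ o x v st, G.lab e = .write o x v st → o = Mode.rlx ∨ o = Mode.rel
  fence_mode : ∀ e ∈ G.E, ∀ o, G.lab e = .fence o →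
    o = Mode.acq ∨ o = Mode.rel ∨ o = Mode.acqrel ∨ o = Mode.sc
  rmw_sub : ∀ a b, G.rmw a b → a ∈ G.Rex ∧ b ∈ G.W ∧ G.sameLoc a b ∧ immediate G.po a b
  strong_rmw : G.Wstrong ⊆ rcodom G.rmw
  data_sub : ∀ a b, G.data a b → a ∈ G.R ∧ G.po a b ∧ b ∈ G.W
  addr_sub : ∀ a b, G.addr a b → a ∈ G.R ∧ G.po a b ∧ (b ∈ G.R ∨ b ∈ G.W)
  ctrl_sub : ∀ a b, G.ctrl a b → a ∈ G.R ∧ G.po a b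
  ctrl_po : ∀ a b c, G.ctrl a b → G.po b c → G.ctrl a c
  casdep_sub : ∀ a b, G.casdep a b → a ∈ G.R ∧ G.po a b ∧ b ∈ G.Rex
  rf_sub : ∀ a b, G.rf a b → a ∈ G.W ∧ b ∈ G.R ∧ G.sameLoc a b
  rf_val : ∀ a b, G.rf a b → G.valu a = G.valu b
  rf_func : ∀ a b c, G.rf a c → G.rf b c → a = b
  co_sub : ∀ a b, G.co a b → a ∈ G.W ∧ b ∈ G.W ∧ G.sameLoc a b
  co_trans : Transitive G.co
  co_irr : Irreflexive G.co

/-- IMM-consistency (Definition 3.1) -/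
def IMMConsistent (G : Execution) : Prop :=
  rcodom G.rf = G.R ∧
  (∀ x, totalOn (G.Wloc x) G.co) ∧
  Irreflexive (G.hb ⬝ rcl G.eco) ∧
  (∀ a b, G.rmw a b → ¬ (G.fre ⬝ G.coe) a b) ∧
  acyclic G.ar

/-! ## IMM with a total order on SC fences (IMM_sc) -/

/-- `sc` is a strict total order on the SC fences of `G` -/
def scWf (G : Execution) (sc : REv) : Prop :=
  (∀ a b, sc a b → a ∈ G.Fsc ∧ b ∈ G.Fsc) ∧
  Transitive sc ∧ Irreflexive sc ∧ totalOn G.Fsc sc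

/-- `ar_sc`: the acyclicity relation of IMM with `psc` replaced by `sc` -/
def arSC (G : Execution) (sc : REv) : REv :=
  G.rfe ∪ᵣ G.bob ∪ᵣ G.ppo ∪ᵣ G.detour ∪ᵣ sc ∪ᵣ ⦗G.Wstrong⦘ ⬝ G.po ⬝ ⦗G.W⦘

/-- IMM_sc-consistency (the variant using `hb_RC11`). -/
def IMMscConsistent (G : Execution) (sc : REv) : Prop :=
  rcodom G.rf = G.R ∧
  (∀ x, totalOn (G.Wloc x) G.co) ∧
  Irreflexive (G.hbRC11 ⬝ rcl G.eco) ∧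
  (∀ a b, G.rmw a b → ¬ (G.fre ⬝ G.coe) a b) ∧
  acyclic (arSC G sc) ∧
  Irreflexive (sc ⬝ G.hbRC11 ⬝ rcl (G.eco ⬝ G.hbRC11))

/-- IMM_sc-consistency in the variant using the full `hb` (instead of `hb_RC11`):
the other IMM-consistency axioms together with acyclicity of `ar_sc` and
irreflexivity of `sc;hb;(eco;hb)^?`. -/
def IMMscConsistentHB (G : Execution) (sc : REv) : Prop :=
  rcodom G.rf = G.R ∧
  (∀ x, totalOn (G.Wloc x) G.co) ∧
  Irreflexive (G.hb ⬝ rcl G.eco) ∧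
  (∀ a b, G.rmw a b → ¬ (G.fre ⬝ G.coe) a b) ∧
  acyclic (arSC G sc) ∧
  Irreflexive (sc ⬝ G.hb ⬝ rcl (G.eco ⬝ G.hb))

theorem evLt_trans {a b c : Event} (hab : evLt a b) (hbc : evLt b c) : evLt a c := by
  cases a <;> cases b <;> cases c <;> simp only [evLt] at hab hbc ⊢
  exact ⟨hab.1.trans hbc.1, hab.2.trans hbc.2⟩

theorem rcl_trans {r : REv} (hr : Transitive r) {a b c : Event}
    (hab : rcl r a b) (hbc : rcl r b c) : rcl r a c := by
  rcases hab with rfl | hab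
  · exact hbc
  · rcases hbc with rfl | hbc
    · exact Or.inr hab
    · exact Or.inr (hr hab hbc)

/-- An acyclic relation is contained in a strict total order. -/
theorem acyclic.exists_strict_total {r : REv} (hr : acyclic r) :
    ∃ t : REv, Transitive t ∧ Irreflexive t ∧ (∀ a b, a ≠ b → t a b ∨ t b a) ∧
      ∀ a b, r a b → t a b := by
  have hpo : IsPartialOrder Event (Relation.ReflTransGen r) :=
    { refl := fun _ => .refl
      trans := fun _ _ _ => .trans
      antisymm := fun a b hab hba => by
        rcases Relation.reflTransGen_iff_eq_or_transGen.mp hab with h | h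
        · exact h.symm
        · exact absurd (h.trans_left hba) (hr a) }
  obtain ⟨s, hs, hle⟩ := extend_partialOrder (Relation.ReflTransGen r)
  refine ⟨fun a b => s a b ∧ a ≠ b, ?_, fun a h => h.2 rfl, ?_, ?_⟩
  · rintro a b c ⟨hab, hne⟩ ⟨hbc, -⟩
    refine ⟨hs.trans _ _ _ hab hbc, ?_⟩
    rintro rfl
    exact hne (hs.antisymm _ _ hab hbc)
  · intro a b hne
    exact (hs.total a b).imp (fun h => ⟨h, hne⟩) fun h => ⟨h, hne.symm⟩
  · intro a b hab
    refine ⟨hle _ _ (.single hab), ?_⟩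
    rintro rfl
    exact hr a (.single hab)

theorem acyclic_of_le {r t : REv} (ht : Transitive t) (hirr : Irreflexive t)
    (hle : ∀ a b, r a b → t a b) : acyclic r := by
  have key : ∀ {a b}, tcl r a b → t a b := by
    intro a b h
    induction h with
    | single h => exact hle _ _ h
    | tail _ h ih => exact ht ih (hle _ _ h)
  exact fun a h => hirr a (key h)

namespace Execution

variable {G : Execution}

theorem po_trans : Transitive G.po :=
  fun _ _ _ hab hbc => ⟨hab.1, hbc.2.1, evLt_trans hab.2.2 hbc.2.2⟩

theorem hb_trans : Transitive G.hb :=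
  fun _ _ _ => Relation.TransGen.trans

theorem sameLoc_trans : Transitive G.sameLoc := by
  rintro a b c ⟨x, ha, hb⟩ ⟨y, hb', hc⟩
  exact ⟨x, ha, by rw [hc, ← hb', hb]⟩

theorem poloc_trans : Transitive G.poloc :=
  fun _ _ _ hab hbc => ⟨po_trans hab.1 hbc.1, sameLoc_trans hab.2 hbc.2⟩

theorem rcl_po_of_rcl_poloc {a b : Event} (h : rcl G.poloc a b) : rcl G.po a b :=
  h.imp_right And.left

theorem Fsc_subset_F : G.Fsc ⊆ G.F := fun _ h => ⟨h.1, _, h.2⟩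

theorem FgeRel_subset_F : G.FgeRel ⊆ G.F := by
  rintro e ⟨he, h | h | h⟩ <;> exact ⟨he, _, h⟩

theorem Rex_subset_R : G.Rex ⊆ G.R :=
  fun _ ⟨he, _, _, _, h⟩ => ⟨he, _, _, _, _, h⟩

theorem ar_of_bob {a b : Event} (h : G.bob a b) : G.ar a b :=
  Or.inl (Or.inl (Or.inl (Or.inl (Or.inr h))))

theorem ar_of_rfe {a b : Event} (h : G.rfe a b) : G.ar a b :=
  Or.inl (Or.inl (Or.inl (Or.inl (Or.inl h))))

theorem ar_of_psc {a b : Event} (h : G.psc a b) : G.ar a b :=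
  Or.inl (Or.inr h)

theorem ar_of_Rex_po_W {a b : Event} (ha : a ∈ G.Rex) (h : G.po a b) (hb : b ∈ G.W) :
    G.ar a b :=
  Or.inl (Or.inl (Or.inl (Or.inr
    ⟨a, ⟨rfl, Rex_subset_R ha⟩, b, .single (Or.inl (Or.inr ⟨a, ⟨rfl, ha⟩, h⟩)), rfl, hb⟩)))

theorem ar_of_po_release {a b : Event} (h : G.po a b) (hb : b ∈ G.Wrel ∨ b ∈ G.F) :
    G.ar a b := by
  rcases hb with hb | hb
  · exact ar_of_bob (Or.inl (Or.inl (Or.inl (Or.inl ⟨b, h, rfl, hb⟩))))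
  · exact ar_of_bob (Or.inl (Or.inl (Or.inr ⟨b, h, rfl, hb⟩)))

theorem ar_of_F_po {a b : Event} (ha : a ∈ G.F) (h : G.po a b) : G.ar a b :=
  ar_of_bob (Or.inl (Or.inr ⟨a, ⟨rfl, ha⟩, h⟩))

theorem ar_of_Wrel_poloc_W {a b : Event} (ha : a ∈ G.Wrel) (h : G.poloc a b) (hb : b ∈ G.W) :
    G.ar a b :=
  ar_of_bob (Or.inr ⟨a, ⟨rfl, ha⟩, b, h, rfl, hb⟩)

/-- `s` reaches `w` by `ar* ; po^?` through some `y` which is `ar*`-before every write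
in `po|loc^?` after `w`. -/
def arReachesWrites (G : Execution) (s w : Event) : Prop :=
  ∃ y, rtcl G.ar s y ∧ rcl G.po y w ∧ ∀ w' ∈ G.W, rcl G.poloc w w' → rtcl G.ar y w'

theorem arReachesWrites.trans_poloc {s w w' : Event} (h : G.arReachesWrites s w)
    (hw : rcl G.poloc w w') : G.arReachesWrites s w' := by
  obtain ⟨y, hsy, hyw, hy⟩ := h
  exact ⟨y, hsy, rcl_trans po_trans hyw (rcl_po_of_rcl_poloc hw),
    fun v hv hwv => hy v hv (rcl_trans poloc_trans hw hwv)⟩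

theorem arReachesWrites.step (hwf : ExecWf G) {s w w' : Event} (h : G.arReachesWrites s w)
    (hw : (rcl G.poloc ⬝ G.rf ⬝ G.rmw) w w') : G.arReachesWrites s w' := by
  obtain ⟨v, hwv, r, hrf, hrmw⟩ := hw
  obtain ⟨hv, -, hloc⟩ := hwf.rf_sub _ _ hrf
  obtain ⟨hr, -, hloc', hpo, -⟩ := hwf.rmw_sub _ _ hrmw
  by_cases hvr : G.po v r
  · exact (h.trans_poloc hwv).trans_poloc
      (Or.inr ⟨po_trans hvr hpo, sameLoc_trans hloc hloc'⟩)
  · obtain ⟨y, hsy, -, hy⟩ := h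
    refine ⟨r, (hsy.trans (hy v hv hwv)).tail (ar_of_rfe ⟨hrf, hvr⟩), Or.inr hpo, ?_⟩
    intro u hu hw'u
    refine .single (ar_of_Rex_po_W hr ?_ hu)
    rcases hw'u with rfl | hw'u
    · exact hpo
    · exact po_trans hpo hw'u.1

theorem release_source {s w : Event} (h : G.release s w) : s ∈ G.Wrel ∨ s ∈ G.F := by
  obtain ⟨_, ⟨-, h⟩ | ⟨_, ⟨-, h⟩, -⟩, -⟩ := h
  · exact Or.inl h
  · exact Or.inr (FgeRel_subset_F h)

theorem arReachesWrites_of_release (hwf : ExecWf G) {s w : Event} (h : G.release s w) :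
    G.arReachesWrites s w := by
  obtain ⟨v, hsv, hrs⟩ := h
  have hbase : G.arReachesWrites s v := by
    rcases hsv with ⟨rfl, hs⟩ | ⟨_, ⟨rfl, hs⟩, hpo⟩
    · refine ⟨s, .refl, Or.inl rfl, ?_⟩
      rintro u hu (rfl | hsu)
      · exact .refl
      · exact .single (ar_of_Wrel_poloc_W hs hsu hu)
    · refine ⟨s, .refl, Or.inr hpo, ?_⟩
      rintro u hu (rfl | hvu)
      · exact .single (ar_of_F_po (FgeRel_subset_F hs) hpo)
      · exact .single (ar_of_F_po (FgeRel_subset_F hs) (po_trans hpo hvu.1))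
  rcases hrs with ⟨_, ⟨rfl, -⟩, _, hpo, rfl, -⟩ | ⟨_, ⟨rfl, -⟩, hsteps⟩
  · exact hbase.trans_poloc (Or.inr hpo)
  · change Relation.ReflTransGen _ _ _ at hsteps
    induction hsteps with
    | refl => exact hbase
    | tail _ hstep ih => exact ih.step hwf hstep

theorem sw_source {a b : Event} (h : G.sw a b) : a ∈ G.Wrel ∨ a ∈ G.F := by
  obtain ⟨_, h, -⟩ := h
  exact release_source h

theorem sw_subset_ar_po (hwf : ExecWf G) {a b : Event} (h : G.sw a b) :
    (rtcl G.ar ⬝ rcl G.po) a b := by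
  obtain ⟨w, hrel, r, hwr, hrb⟩ := h
  have hrb' : rcl G.po r b := by
    rcases hrb with ⟨rfl, -⟩ | ⟨_, hpo, rfl, -⟩
    · exact Or.inl rfl
    · exact Or.inr hpo
  obtain ⟨y, hay, hyw, hy⟩ := arReachesWrites_of_release hwf hrel
  rcases hwr with hrfi | ⟨v, hwv, hrfe⟩
  · exact ⟨y, hay, rcl_trans po_trans (rcl_trans po_trans hyw (Or.inr hrfi.2)) hrb'⟩
  · exact ⟨r, (hay.trans (hy v (hwf.rf_sub _ _ hrfe.1).1 hwv)).tail (ar_of_rfe hrfe), hrb'⟩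

theorem hb_subset_ar_po (hwf : ExecWf G) {a b : Event} (h : G.hb a b) :
    (rtcl G.ar ⬝ rcl G.po) a b := by
  have key : ∀ {x z}, (rtcl G.ar ⬝ rcl G.po) a x → (G.po ∪ᵣ G.sw) x z →
      (rtcl G.ar ⬝ rcl G.po) a z := by
    rintro x z ⟨y, hay, hyx⟩ (hpo | hsw)
    · exact ⟨y, hay, rcl_trans po_trans hyx (Or.inr hpo)⟩
    · obtain ⟨u, hxu, huz⟩ := sw_subset_ar_po hwf hsw
      rcases hyx with rfl | hyx
      · exact ⟨u, hay.trans hxu, huz⟩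
      · exact ⟨u, (hay.tail (ar_of_po_release hyx (sw_source hsw))).trans hxu, huz⟩
  change Relation.TransGen _ _ _ at h
  induction h with
  | single h => exact key ⟨a, .refl, Or.inl rfl⟩ h
  | tail _ h ih => exact key ih h

theorem hb_to_F_subset_ar (hwf : ExecWf G) {a b : Event} (h : G.hb a b) (hb : b ∈ G.F) :
    rtcl G.ar a b := by
  obtain ⟨y, hay, rfl | hyb⟩ := hb_subset_ar_po hwf h
  · exact hay
  · exact hay.tail (ar_of_po_release hyb (Or.inr hb))

theorem rsRC11_rf_subset (hwf : ExecWf G) {a b c : Event} (hab : G.rsRC11 a b)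
    (hbc : G.rf b c) : G.rs a b := by
  obtain ⟨_, ⟨rfl, ha⟩, v, hav, hvb⟩ := hab
  rcases Relation.ReflTransGen.cases_head hvb with rfl | ⟨u, ⟨r, hvr, hru⟩, hub⟩
  · rcases hav with rfl | hav
    · exact Or.inr ⟨a, ⟨rfl, ha⟩, .refl⟩
    · exact Or.inl ⟨a, ⟨rfl, ha⟩, v, hav, rfl, (hwf.rf_sub _ _ hbc).1⟩
  · refine Or.inr ⟨a, ⟨rfl, ha⟩, Relation.ReflTransGen.head ⟨v, hav, r, hvr, hru⟩ ?_⟩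
    exact Relation.ReflTransGen.mono (fun x _ h => ⟨x, Or.inl rfl, h⟩) _ _ hub

theorem swRC11_subset_sw (hwf : ExecWf G) {a b : Event} (h : G.swRC11 a b) : G.sw a b := by
  obtain ⟨w, ⟨v, hav, hvw⟩, r, hwr, hrb⟩ := h
  refine ⟨w, ⟨v, hav, rsRC11_rf_subset hwf hvw hwr⟩, r, ?_, hrb⟩
  by_cases hpo : G.po w r
  · exact Or.inl ⟨hwr, hpo⟩
  · exact Or.inr ⟨w, Or.inl rfl, hwr, hpo⟩

theorem hbRC11_subset_hb (hwf : ExecWf G) {a b : Event} (h : G.hbRC11 a b) : G.hb a b :=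
  Relation.TransGen.mono (fun _ _ h => Or.imp_right (swRC11_subset_sw hwf) h) _ _ h

/-- For a total `sc` that respects `hb` and `eco`, the relation `psc` is contained in `sc`. -/
theorem psc_subset_sc {sc : REv} (hsc : scWf G sc) (hG : IMMscConsistentHB G sc)
    {a b : Event} (h : G.psc a b) : sc a b := by
  obtain ⟨-, -, hcoh, -, -, hirr⟩ := hG
  obtain ⟨_, ⟨rfl, ha⟩, c, hac, d, hcd, b, hdb, rfl, hb⟩ := h
  have hne : a ≠ b := by
    rintro rfl
    exact hcoh d ⟨c, hb_trans hdb hac, Or.inr hcd⟩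
  rcases hsc.2.2.2 a ha b hb hne with h | h
  · exact h
  · exact absurd ⟨a, h, c, hac, Or.inr ⟨d, hcd, hdb⟩⟩ (hirr b)

theorem ar_subset_arSC {sc : REv} (h : ∀ a b, G.psc a b → sc a b) {a b : Event}
    (hab : G.ar a b) : arSC G sc a b :=
  hab.imp_left fun hab => hab.imp_right (h a b)

/-- The strict total order `t` restricted to the SC fences. -/
def scOf (G : Execution) (t : REv) : REv := fun a b => a ∈ G.Fsc ∧ b ∈ G.Fsc ∧ t a b

theorem scWf_scOf {t : REv} (ht : Transitive t) (hirr : Irreflexive t)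
    (htot : ∀ a b, a ≠ b → t a b ∨ t b a) : scWf G (G.scOf t) :=
  ⟨fun _ _ h => ⟨h.1, h.2.1⟩, fun _ _ _ hab hbc => ⟨hab.1, hbc.2.1, ht hab.2.2 hbc.2.2⟩,
    fun a h => hirr a h.2.2, fun a ha b hb hne =>
      (htot a b hne).imp (fun h => ⟨ha, hb, h⟩) fun h => ⟨hb, ha, h⟩⟩

theorem arSC_scOf_subset {t : REv} (hle : ∀ a b, G.ar a b → t a b) {a b : Event}
    (h : arSC G (G.scOf t) a b) : t a b := by
  rcases h with (h | h) | h
  · exact hle a b (Or.inl (Or.inl h))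
  · exact h.2.2
  · exact hle a b (Or.inr h)

theorem irreflexive_scOf_hb (hwf : ExecWf G) {t : REv} (ht : Transitive t)
    (hirr : Irreflexive t) (hle : ∀ a b, G.ar a b → t a b) :
    Irreflexive (G.scOf t ⬝ G.hb ⬝ rcl (G.eco ⬝ G.hb)) := by
  rintro a ⟨b, ⟨ha, hb, hab⟩, c, hbc, rfl | ⟨d, hcd, hda⟩⟩
  · have hba := hb_to_F_subset_ar hwf hbc (Fsc_subset_F ha)
    rcases Relation.reflTransGen_iff_eq_or_transGen.mp hba with rfl | hba
    · exact hirr _ hab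
    · exact acyclic_of_le ht hirr (r := t) (fun _ _ h => h) _
        ((Relation.TransGen.mono hle _ _ hba).head hab)
  · exact hirr a (ht hab (hle _ _ (ar_of_psc
      ⟨b, ⟨rfl, hb⟩, c, hbc, d, hcd, a, hda, rfl, ha⟩)))

end Execution

theorem IMMConsistent.exists_sc {G : Execution} (hwf : ExecWf G) (hG : IMMConsistent G) :
    ∃ sc : REv, scWf G sc ∧ IMMscConsistentHB G sc := by
  obtain ⟨hrf, hco, hcoh, hat, hac⟩ := hG
  obtain ⟨t, ht, hirr, htot, hle⟩ := hac.exists_strict_total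
  exact ⟨G.scOf t, Execution.scWf_scOf ht hirr htot, hrf, hco, hcoh, hat,
    acyclic_of_le ht hirr fun _ _ => Execution.arSC_scOf_subset hle,
    Execution.irreflexive_scOf_hb hwf ht hirr hle⟩

theorem IMMscConsistentHB.immConsistent {G : Execution} {sc : REv} (hsc : scWf G sc)
    (hG : IMMscConsistentHB G sc) : IMMConsistent G := by
  have hle := fun a b => Execution.psc_subset_sc (a := a) (b := b) hsc hG
  obtain ⟨hrf, hco, hcoh, hat, hac, -⟩ := hG
  exact ⟨hrf, hco, hcoh, hat, fun a h =>
    hac a (Relation.TransGen.mono (fun _ _ => Execution.ar_subset_arSC hle) _ _ h)⟩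

theorem IMMscConsistentHB.immscConsistent {G : Execution} {sc : REv} (hwf : ExecWf G)
    (hG : IMMscConsistentHB G sc) : IMMscConsistent G sc := by
  obtain ⟨hrf, hco, hcoh, hat, hac, hirr⟩ := hG
  refine ⟨hrf, hco, ?_, hat, hac, ?_⟩
  · rintro a ⟨b, hab, hba⟩
    exact hcoh a ⟨b, Execution.hbRC11_subset_hb hwf hab, hba⟩
  · rintro a ⟨b, hab, c, hbc, hca⟩
    refine hirr a ⟨b, hab, c, Execution.hbRC11_subset_hb hwf hbc, hca.imp_right ?_⟩
    rintro ⟨d, hcd, hda⟩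
    exact ⟨d, hcd, Execution.hbRC11_subset_hb hwf hda⟩

/-- an execution graph is IMM-consistent iff there exists a strict total
order `sc` on its SC fences such that the other IMM-consistency axioms hold, `ar_sc`
(i.e. `ar` with `psc` replaced by `sc`) is acyclic and `sc;hb;(eco;hb)^?` is
irreflexive.  Moreover, if `G` is IMM-consistent, then there is such an `sc` for which
`G` is also IMM_sc-consistent in the variant using `hb_RC11` in place of `hb`. -/
theorem imm_sc_equivalence (G : Execution) (hwf : ExecWf G) :
    (IMMConsistent G ↔ ∃ sc : REv, scWf G sc ∧ IMMscConsistentHB G sc) ∧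
    (IMMConsistent G → ∃ sc : REv, scWf G sc ∧ IMMscConsistent G sc) := by
  refine ⟨⟨fun h => h.exists_sc hwf, fun ⟨_, hsc, h⟩ => h.immConsistent hsc⟩, fun h => ?_⟩
  obtain ⟨sc, hsc, hG⟩ := h.exists_sc hwf
  exact ⟨sc, hsc, hG.immscConsistent hwf⟩
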